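/- arXiv:2512.23229 — 7 statements merged into one kernel-verified Lean document; each statement's English description precedes it below -/
import Mathlib

section
/- Let n ≥ 2, let X ⊆ ℝⁿ be closed, let s ∈ ℝⁿ with s ∉ X, let R > 0, and let Y be a nonempty subset of the sphere {y : ‖y − s‖ = R} with dimH X < dimH Y. Then there exists y ∈ Y such that the closed segment [s, y] (i.e., segment ℝ s y) is disjoint from X. -/
/-- The central projection from `s` onto the sphere of radius `R` around `s` does not increase
the Hausdorff dimension of a set that misses `s`. -/
theorem dimH_image_radialProjection_le {E : Type*} [NormedAddCommGroup E] [InnerProductSpace ℝ E]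
    [SecondCountableTopology E] {s : E} {X : Set E} (hs : s ∉ X) (R : ℝ) :
    dimH ((fun x ↦ s + (R / ‖x - s‖) • (x - s)) '' X) ≤ dimH X := by
  refine dimH_image_le_of_locally_lipschitzOn fun x hx ↦ ?_
  have hne : x - s ≠ 0 := sub_ne_zero.mpr fun h ↦ hs (h ▸ hx)
  have hsub : ContDiffAt ℝ 1 (fun x ↦ x - s) x := contDiffAt_id.sub contDiffAt_const
  have hsmooth : ContDiffAt ℝ 1 (fun x ↦ s + (R / ‖x - s‖) • (x - s)) x :=
    contDiffAt_const.add
      ((contDiffAt_const.div (hsub.norm ℝ hne) (norm_ne_zero_iff.mpr hne)).smul hsub)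
  obtain ⟨C, t, ht, hC⟩ := hsmooth.exists_lipschitzOnWith
  exact ⟨C, t, mem_nhdsWithin_of_mem_nhds ht, hC⟩

/-- A point of the sphere of radius `R` around `s` is the radial projection of every point other
than `s` on the segment joining it to `s`. -/
theorem radialProjection_eq_of_mem_segment {E : Type*} [NormedAddCommGroup E] [NormedSpace ℝ E]
    {s x y : E} {R : ℝ} (hy : ‖y - s‖ = R) (hx : x ∈ segment ℝ s y) (hxs : x ≠ s) :
    s + (R / ‖x - s‖) • (x - s) = y := by
  rw [segment_eq_image'] at hx
  obtain ⟨t, ⟨ht, -⟩, rfl⟩ := hx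
  have ht0 : t ≠ 0 := by rintro rfl; simp at hxs
  have hys : ‖y - s‖ ≠ 0 := by
    rw [norm_ne_zero_iff]
    intro h
    simp [h] at hxs
  subst hy
  simp only [add_sub_cancel_left, norm_smul, Real.norm_of_nonneg ht, smul_smul]
  have hcoef : ‖y - s‖ / (t * ‖y - s‖) * t = 1 := by field_simp
  rw [hcoef, one_smul, add_sub_cancel]

/-- Theorem 2.1 (sphere form): if `X` is closed, `s ∉ X`, and `Y` is a nonempty subset
of the sphere of radius `R` around `s` with `dimH X < dimH Y`, then some segment
from `s` to a point of `Y` avoids `X`. -/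
theorem exists_segment_avoiding_of_dimH_lt_sphere
    (n : ℕ) (hn : 2 ≤ n) (X : Set (EuclideanSpace ℝ (Fin n))) (hX : IsClosed X)
    (s : EuclideanSpace ℝ (Fin n)) (hs : s ∉ X) (R : ℝ) (hR : 0 < R)
    (Y : Set (EuclideanSpace ℝ (Fin n))) (hYne : Y.Nonempty)
    (hYsphere : Y ⊆ {y | ‖y - s‖ = R}) (hdim : dimH X < dimH Y) :
    ∃ y ∈ Y, Disjoint (segment ℝ s y) X := by
  by_contra! h
  refine hdim.not_ge ((dimH_mono fun y hy ↦ ?_).trans (dimH_image_radialProjection_le hs R))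
  obtain ⟨x, hxseg, hxX⟩ := Set.not_disjoint_iff.mp (h y hy)
  exact ⟨x, hxX, radialProjection_eq_of_mem_segment (hYsphere hy) hxseg fun e ↦ hs (e ▸ hxX)⟩
end

section
/- Let n ≥ 2, let X ⊆ ℝⁿ be closed, let s ∈ ℝⁿ with s ∉ X, and let Y ⊆ ℝⁿ be a set satisfying dimH X + 1 < dimH Y. Then there exists y ∈ Y such that the closed segment [s, y] (i.e., segment ℝ s y) is disjoint from X. -/
open Set Filter Topology MeasureTheory Metric
open scoped NNReal ENNReal

/-- A set of zero `d`-dimensional Hausdorff measure, `d > 0`, has countable covers by small sets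
with arbitrarily small `d`-dimensional size, where each set is assigned a positive upper bound
of its diameter. -/
theorem exists_cover_of_hausdorffMeasure_eq_zero {X : Type*} [EMetricSpace X] [MeasurableSpace X]
    [BorelSpace X] {d : ℝ} (hd : 0 < d) {A : Set X} (hA : μH[d] A = 0) {ε : ℝ≥0} (hε : 0 < ε) :
    ∃ (T : ℕ → Set X) (δ : ℕ → ℝ≥0), A ⊆ ⋃ n, T n ∧ (∀ n, 0 < δ n) ∧ (∀ n, δ n ≤ ε) ∧
      (∀ n, ediam (T n) ≤ δ n) ∧ ∑' n, (δ n : ℝ≥0∞) ^ d ≤ ε := by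
  have hε0 : (0 : ℝ≥0∞) < ε := by exact_mod_cast hε
  have hε2 : (0 : ℝ≥0∞) < ε / 2 := ENNReal.half_pos hε0.ne'
  rw [Measure.hausdorffMeasure_apply] at hA
  simp only [ENNReal.iSup_eq_zero] at hA
  have hA' := (hA ε hε0).trans_lt hε2
  simp only [iInf_lt_iff] at hA'
  obtain ⟨T, hT, hdiam, hsum⟩ := hA'
  obtain ⟨η, hη, hηsum⟩ := ENNReal.exists_pos_sum_of_countable' hε2.ne' ℕ
  let D : ℕ → ℝ≥0∞ := fun n => max (ediam (T n)) (min ε (η n ^ d⁻¹))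
  have hDle : ∀ n, D n ≤ ε := fun n => max_le (hdiam n) (min_le_left _ _)
  have hDtop : ∀ n, D n ≠ ∞ := fun n => ne_top_of_le_ne_top ENNReal.coe_ne_top (hDle n)
  have hηtop : ∀ n, η n ≠ ∞ := ENNReal.ne_top_of_tsum_ne_top hηsum.ne_top
  have hDpos : ∀ n, 0 < D n := fun n =>
    lt_max_of_lt_right (lt_min hε0 (ENNReal.rpow_pos (hη n) (hηtop n)))
  have hDpow : ∀ n, D n ^ d ≤ (⨆ _ : (T n).Nonempty, ediam (T n) ^ d) + η n := by
    intro n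
    rcases max_choice (ediam (T n)) (min ε (η n ^ d⁻¹)) with h | h
    · refine le_add_right ?_
      have hDn : D n = ediam (T n) := h
      have hne : (T n).Nonempty := by
        by_contra hne
        have := hDpos n
        rw [hDn, not_nonempty_iff_eq_empty.1 hne] at this
        simp at this
      rw [hDn]
      exact le_iSup (fun _ : (T n).Nonempty => ediam (T n) ^ d) hne
    · refine le_add_left ?_
      have hDn : D n = min (ε : ℝ≥0∞) (η n ^ d⁻¹) := h
      calc D n ^ d ≤ (η n ^ d⁻¹) ^ d :=
            ENNReal.rpow_le_rpow (hDn ▸ min_le_right _ _) hd.le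
        _ = η n := ENNReal.rpow_inv_rpow hd.ne' _
  refine ⟨T, fun n => (D n).toNNReal, hT, fun n => ENNReal.toNNReal_pos (hDpos n).ne' (hDtop n),
    fun n => by simpa using ENNReal.toNNReal_mono ENNReal.coe_ne_top (hDle n), fun n => ?_, ?_⟩
  · rw [ENNReal.coe_toNNReal (hDtop n)]
    exact le_max_left _ _
  · simp only [ENNReal.coe_toNNReal (hDtop _)]
    calc ∑' n, D n ^ d ≤ ∑' n, ((⨆ _ : (T n).Nonempty, ediam (T n) ^ d) + η n) :=
          ENNReal.tsum_le_tsum hDpow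
      _ = (∑' n, ⨆ _ : (T n).Nonempty, ediam (T n) ^ d) + ∑' n, η n := ENNReal.tsum_add
      _ ≤ ε / 2 + ε / 2 := add_le_add hsum.le hηsum.le
      _ = ε := ENNReal.add_halves _

/-- The product of a set of zero `d`-dimensional Hausdorff measure with a unit interval has zero
`(d + 1)`-dimensional Hausdorff measure. -/
theorem hausdorffMeasure_prod_Icc_eq_zero {X : Type*} [EMetricSpace X] [MeasurableSpace X]
    [BorelSpace X] [MeasurableSpace (X × ℝ)] [BorelSpace (X × ℝ)] {d : ℝ} (hd : 0 < d)
    {A : Set X} (hA : μH[d] A = 0) (a : ℝ) :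
    μH[d + 1] (A ×ˢ Icc a (a + 1)) = 0 := by
  let e : ℕ → ℝ≥0 := fun k => 1 / (k + 1)
  have he0 : ∀ k, 0 < e k := fun k => by positivity
  have he1 : ∀ k, e k ≤ 1 := fun k => div_le_one_of_le₀ (by simp) (by positivity)
  have helim : Tendsto e atTop (𝓝 0) := tendsto_one_div_add_atTop_nhds_zero_nat
  have helim' : Tendsto (fun k => (e k : ℝ≥0∞)) atTop (𝓝 0) := by
    simpa using ENNReal.tendsto_coe.2 helim
  choose T δ hT hδ0 hδe hdiam hsum using
    fun k => exists_cover_of_hausdorffMeasure_eq_zero hd hA (he0 k)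
  let N : ℕ → ℕ → ℕ := fun k n => ⌊1 / (δ k n : ℝ)⌋₊ + 1
  let t : ∀ k, (Σ n, Fin (N k n)) → Set (X × ℝ) := fun k i =>
    T k i.1 ×ˢ Icc (a + (i.2 : ℕ) * δ k i.1) (a + (i.2 : ℕ) * δ k i.1 + δ k i.1)
  have htdiam : ∀ k i, ediam (t k i) ≤ δ k i.1 := by
    intro k i
    refine ediam_le fun x hx y hy => ?_
    rw [Prod.edist_eq]
    refine max_le ((edist_le_ediam_of_mem hx.1 hy.1).trans (hdiam k i.1)) ?_
    refine (edist_le_ediam_of_mem hx.2 hy.2).trans ?_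
    rw [Real.ediam_Icc, add_sub_cancel_left, ENNReal.ofReal_coe_nnreal]
  have hcover : ∀ k, A ×ˢ Icc a (a + 1) ⊆ ⋃ i, t k i := by
    rintro k ⟨x, u⟩ ⟨hx, hu⟩
    obtain ⟨n, hn⟩ := mem_iUnion.1 (hT k hx)
    have hpos : (0 : ℝ) < δ k n := hδ0 k n
    have hj0 : 0 ≤ (u - a) / δ k n := div_nonneg (by linarith [hu.1]) hpos.le
    have hj : ⌊(u - a) / δ k n⌋₊ < N k n :=
      Nat.lt_succ_of_le (Nat.floor_mono (by gcongr; linarith [hu.2]))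
    refine mem_iUnion.2 ⟨⟨n, ⟨_, hj⟩⟩, hn, ?_, ?_⟩
    · have := Nat.floor_le hj0
      rw [le_div_iff₀ hpos] at this
      dsimp only
      linarith
    · have := (Nat.lt_floor_add_one ((u - a) / δ k n)).le
      rw [div_le_iff₀ hpos] at this
      dsimp only
      linarith
  have hcount : ∀ k n, (N k n : ℝ≥0∞) * (δ k n : ℝ≥0∞) ^ (d + 1) ≤ 2 * (δ k n : ℝ≥0∞) ^ d := by
    intro k n
    have hpos : (0 : ℝ) < δ k n := hδ0 k n
    have hle1 : (δ k n : ℝ) ≤ 1 := (hδe k n).trans (he1 k)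
    have hN : (N k n : ℝ) * δ k n ≤ 2 := by
      have h := Nat.floor_le (one_div_nonneg.2 hpos.le)
      rw [le_div_iff₀ hpos] at h
      simp only [N]
      push_cast
      linarith
    have hN' : (N k n : ℝ≥0∞) * (δ k n : ℝ≥0∞) ≤ 2 := by exact_mod_cast hN
    rw [ENNReal.rpow_add_of_nonneg _ _ hd.le zero_le_one, ENNReal.rpow_one, mul_comm (_ ^ d),
      ← mul_assoc]
    gcongr
  have htsum : ∀ k, ∑' i, ediam (t k i) ^ (d + 1) ≤ 2 * (e k : ℝ≥0∞) := by
    intro k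
    calc ∑' i, ediam (t k i) ^ (d + 1)
        ≤ ∑' i : (Σ n, Fin (N k n)), (δ k i.1 : ℝ≥0∞) ^ (d + 1) :=
          ENNReal.tsum_le_tsum fun i => ENNReal.rpow_le_rpow (htdiam k i) (by linarith)
      _ = ∑' n, (N k n : ℝ≥0∞) * (δ k n : ℝ≥0∞) ^ (d + 1) := by
          rw [ENNReal.tsum_sigma']
          simp [tsum_fintype]
      _ ≤ ∑' n, 2 * (δ k n : ℝ≥0∞) ^ d := ENNReal.tsum_le_tsum (hcount k)
      _ = 2 * ∑' n, (δ k n : ℝ≥0∞) ^ d := ENNReal.tsum_mul_left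
      _ ≤ 2 * (e k : ℝ≥0∞) := by gcongr; exact hsum k
  have hlim : Tendsto (fun k => ∑' i, ediam (t k i) ^ (d + 1)) atTop (𝓝 0) := by
    refine tendsto_of_tendsto_of_tendsto_of_le_of_le tendsto_const_nhds ?_
      (fun _ => zero_le) htsum
    simpa using ENNReal.Tendsto.const_mul helim' (Or.inr ENNReal.ofNat_ne_top)
  have hmain := Measure.hausdorffMeasure_le_liminf_tsum (d + 1) (A ×ˢ Icc a (a + 1))
    (fun k => (e k : ℝ≥0∞)) helim' t
    (Eventually.of_forall fun k i => (htdiam k i).trans (by exact_mod_cast hδe k i.1))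
    (Eventually.of_forall hcover)
  rw [hlim.liminf_eq] at hmain
  exact nonpos_iff_eq_zero.1 hmain

/-- Taking the product with a line raises the Hausdorff dimension by at most one. -/
theorem dimH_prod_univ_real_le {X : Type*} [EMetricSpace X] (A : Set X) :
    dimH (A ×ˢ (univ : Set ℝ)) ≤ dimH A + 1 := by
  have hcover : A ×ˢ (univ : Set ℝ) ⊆ ⋃ m : ℤ, A ×ˢ Icc (m : ℝ) (m + 1) := by
    rintro ⟨x, u⟩ ⟨hx, -⟩
    exact mem_iUnion.2 ⟨⌊u⌋, hx, Int.floor_le u, (Int.lt_floor_add_one u).le⟩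
  refine (dimH_mono hcover).trans ?_
  rw [dimH_iUnion]
  refine iSup_le fun m => ?_
  rw [← tsub_le_iff_right]
  refine le_of_forall_gt_imp_ge_of_dense fun c hc => ?_
  rcases eq_or_ne c ∞ with rfl | hctop
  · exact le_top
  lift c to ℝ≥0 using hctop
  have hc0 : (0 : ℝ) < c := by exact_mod_cast zero_le.trans_lt hc
  borelize X
  let _ : MeasurableSpace (X × ℝ) := borel (X × ℝ)
  have : BorelSpace (X × ℝ) := ⟨rfl⟩
  have h := hausdorffMeasure_prod_Icc_eq_zero hc0 (hausdorffMeasure_of_dimH_lt hc) (m : ℝ)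
  rw [tsub_le_iff_right]
  have h' : μH[((c + 1 : ℝ≥0) : ℝ)] (A ×ˢ Icc (m : ℝ) (m + 1)) ≠ ∞ := by
    push_cast
    rw [h]
    exact ENNReal.zero_ne_top
  exact_mod_cast dimH_le_of_hausdorffMeasure_ne_top h'

/-- The set of points hidden from `s` by `X` has Hausdorff dimension at most `dimH X + 1`. -/
theorem dimH_setOf_not_disjoint_segment_le {E : Type*} [NormedAddCommGroup E] [NormedSpace ℝ E]
    [FiniteDimensional ℝ E] {X : Set E} {s : E} (hs : s ∉ X) :
    dimH {y | ¬ Disjoint (segment ℝ s y) X} ≤ dimH X + 1 := by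
  let f : E × ℝ → E := fun p => s + p.2 • (p.1 - s)
  have hf : ContDiff ℝ 1 f := by fun_prop
  have hsub : {y | ¬ Disjoint (segment ℝ s y) X} ⊆ f '' (X ×ˢ univ) := by
    intro y hy
    obtain ⟨x, hxs, hxX⟩ := not_disjoint_iff.1 hy
    rw [segment_eq_image'] at hxs
    obtain ⟨a, -, rfl⟩ := hxs
    have ha : a ≠ 0 := by
      rintro rfl
      simp [hs] at hxX
    exact ⟨(_, a⁻¹), ⟨hxX, mem_univ _⟩, by simp [f, smul_smul, ha]⟩
  calc dimH {y | ¬ Disjoint (segment ℝ s y) X} ≤ dimH (f '' (X ×ˢ univ)) := dimH_mono hsub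
    _ ≤ dimH (X ×ˢ (univ : Set ℝ)) :=
        hf.contDiffOn.dimH_image_le convex_univ (subset_univ _)
    _ ≤ dimH X + 1 := dimH_prod_univ_real_le X


/-- Corrected general form of Theorem 2.1: if `X` is closed, `s ∉ X`, and
`dimH X + 1 < dimH Y`, then some segment from `s` to a point of `Y` avoids `X`. -/
theorem exists_segment_avoiding_of_dimH_add_one_lt
    (n : ℕ) (hn : 2 ≤ n) (X : Set (EuclideanSpace ℝ (Fin n))) (hX : IsClosed X)
    (s : EuclideanSpace ℝ (Fin n)) (hs : s ∉ X)
    (Y : Set (EuclideanSpace ℝ (Fin n))) (hdim : dimH X + 1 < dimH Y) :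
    ∃ y ∈ Y, Disjoint (segment ℝ s y) X := by
  by_contra! h
  exact hdim.not_ge ((dimH_mono h).trans (dimH_setOf_not_disjoint_segment_le hs))
end

section
/- Let n ≥ 2, let K ⊆ ℝⁿ be closed with dimH K < n − 1, and let b ∈ ℝⁿ with b ∉ K. Then for every s ∈ ℝⁿ and every ρ > 0 there exists a point y on the sphere {y : ‖y − s‖ = ρ} such that the closed segment [b, y] (i.e., segment ℝ b y) is disjoint from K. -/
open ENNReal

section

open Module

variable {E : Type*} [NormedAddCommGroup E] [InnerProductSpace ℝ E]

/-- A ray that starts in, or passes through, an open ball leaves it through its boundary sphere. -/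
theorem exists_nonneg_norm_smul_sub_eq {v c : E} (hv : v ≠ 0) {ρ t₀ : ℝ} (ht₀ : 0 ≤ t₀)
    (h : ‖t₀ • v - c‖ ≤ ρ) : ∃ t : ℝ, 0 ≤ t ∧ ‖t • v - c‖ = ρ := by
  have hv' : 0 < ‖v‖ := norm_pos_iff.2 hv
  set T : ℝ := max t₀ ((ρ + ‖c‖) / ‖v‖)
  have hT : t₀ ≤ T := le_max_left _ _
  have hρ : ρ ≤ ‖T • v - c‖ := by
    have h₁ : ρ + ‖c‖ ≤ T * ‖v‖ := (div_le_iff₀ hv').1 (le_max_right _ _)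
    have h₂ := norm_sub_norm_le (T • v) c
    rw [norm_smul, Real.norm_of_nonneg (ht₀.trans hT)] at h₂
    linarith
  have hcont : ContinuousOn (fun t : ℝ ↦ ‖t • v - c‖) (Set.Icc t₀ T) := by fun_prop
  obtain ⟨t, ht, hteq⟩ := intermediate_value_Icc hT hcont ⟨h, hρ⟩
  exact ⟨t, ht₀.trans ht.1, hteq⟩

/-- The central projection of a set `K` with `dimH K < dim E - 1` from a point `b` misses
arbitrarily short vectors of the hyperplane orthogonal to `e`, so
that the corresponding rays miss `K`. -/
theorem exists_orthogonal_ray_notMem_of_dimH_lt [FiniteDimensional ℝ E] {K : Set E}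
    (hdim : dimH K < (finrank ℝ E : ℝ≥0∞) - 1) {b e : E} (he : e ≠ 0) {r : ℝ} (hr : 0 < r) :
    ∃ h : E, inner ℝ e h = 0 ∧ ‖h‖ < r ∧ ∀ t : ℝ, 0 < t → b + t • (e + h) ∉ K := by
  let H : Submodule ℝ E := (ℝ ∙ e)ᗮ
  let U : Set E := {x | 0 < inner ℝ e (x - b)}
  let f : E → H := fun x ↦ (‖e‖ ^ 2 / inner ℝ e (x - b)) • H.orthogonalProjectionOnto (x - b)
  have hU : Convex ℝ U := by
    have : U = {x | inner ℝ e b < innerSL ℝ e x} := by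
      ext x; simp [U, inner_sub_right]
    rw [this]
    exact convex_halfSpace_gt (innerSL ℝ e).isLinear _
  have hf : ContDiffOn ℝ 1 f U := by
    have hinner : ContDiffOn ℝ 1 (fun x ↦ inner ℝ e (x - b)) U :=
      contDiffOn_const.inner ℝ (contDiffOn_id.sub contDiffOn_const)
    exact (contDiffOn_const.div hinner fun x (hx : 0 < inner ℝ e (x - b)) ↦ hx.ne').smul
      (by fun_prop)
  have hfin : (finrank ℝ E : ℝ≥0∞) - 1 = finrank ℝ H := by
    have := Submodule.finrank_add_finrank_orthogonal (ℝ ∙ e)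
    rw [finrank_span_singleton he] at this
    rw [← this]
    push_cast
    exact ENNReal.add_sub_cancel_left one_ne_top
  have hdense : Dense (f '' (K ∩ U))ᶜ := by
    refine hf.dense_compl_image_of_dimH_lt_finrank hU Set.inter_subset_right ?_
    rw [← hfin]
    exact (dimH_mono Set.inter_subset_left).trans_lt hdim
  obtain ⟨h, hhK, hhr⟩ := hdense.exists_dist_lt (0 : H) hr
  have hort : inner ℝ e (h : E) = 0 := Submodule.mem_orthogonal_singleton_iff_inner_right.1 h.2
  refine ⟨h, hort, by simpa using hhr, fun t ht hK ↦ hhK ?_⟩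
  have hin : inner ℝ e (t • (e + (h : E))) = t * ‖e‖ ^ 2 := by
    rw [inner_smul_right, inner_add_right, hort, real_inner_self_eq_norm_sq, add_zero]
  have hpos : 0 < ‖e‖ := norm_pos_iff.2 he
  have hproj : H.orthogonalProjectionOnto e = 0 :=
    Submodule.orthogonalProjectionOnto_orthogonalComplement_singleton_eq_zero e
  refine ⟨b + t • (e + (h : E)), ⟨hK, ?_⟩, ?_⟩
  · simp only [U, Set.mem_ofPred_eq, add_sub_cancel_left, hin]
    positivity
  · simp only [f, add_sub_cancel_left, hin, map_smul, map_add, hproj, zero_add,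
      Submodule.orthogonalProjectionOnto_mem_subspace_eq_self, smul_smul]
    rw [show ‖e‖ ^ 2 / (t * ‖e‖ ^ 2) * t = 1 by field_simp, one_smul]

end

/-- Single-step escape lemma: if `K` is closed with `dimH K < n - 1` and `b ∉ K`, then
from `b` one can reach any prescribed sphere by a straight segment avoiding `K`. -/
theorem exists_point_on_sphere_segment_avoiding
    (n : ℕ) (hn : 2 ≤ n) (K : Set (EuclideanSpace ℝ (Fin n))) (hK : IsClosed K)
    (hdim : dimH K < (n : ℝ≥0∞) - 1)
    (b : EuclideanSpace ℝ (Fin n)) (hb : b ∉ K) :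
    ∀ (s : EuclideanSpace ℝ (Fin n)) (ρ : ℝ), 0 < ρ →
      ∃ y : EuclideanSpace ℝ (Fin n), ‖y - s‖ = ρ ∧ Disjoint (segment ℝ b y) K := by
  intro s ρ hρ
  obtain ⟨e, t₀, he, ht₀, hball⟩ : ∃ (e : EuclideanSpace ℝ (Fin n)) (t₀ : ℝ), e ≠ 0 ∧ 0 ≤ t₀ ∧
      ∀ h, ‖h‖ < ρ → ‖t₀ • (e + h) - (s - b)‖ ≤ ρ := by
    rcases eq_or_ne s b with rfl | hsb
    · have : NeZero n := ⟨by lia⟩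
      obtain ⟨e, he⟩ := exists_ne (0 : EuclideanSpace ℝ (Fin n))
      exact ⟨e, 0, he, le_rfl, fun h _ ↦ by simpa using hρ.le⟩
    · exact ⟨s - b, 1, sub_ne_zero.2 hsb, zero_le_one, fun h hh ↦ by simpa using hh.le⟩
  obtain ⟨h, hort, hhρ, hray⟩ := exists_orthogonal_ray_notMem_of_dimH_lt (K := K) (b := b)
    (by simpa using hdim) he hρ
  have hv : e + h ≠ 0 := by
    intro hv
    have := congrArg (inner ℝ e) hv
    rw [inner_add_right, hort, add_zero, inner_zero_right] at this
    exact he (inner_self_eq_zero.1 this)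
  obtain ⟨t, ht, hteq⟩ := exists_nonneg_norm_smul_sub_eq hv ht₀ (hball h hhρ)
  refine ⟨b + t • (e + h), by rwa [show b + t • (e + h) - s = t • (e + h) - (s - b) by abel], ?_⟩
  rw [Set.disjoint_left, segment_eq_image']
  rintro _ ⟨θ, hθ, rfl⟩
  simp only [add_sub_cancel_left, smul_smul]
  rcases (mul_nonneg hθ.1 ht).eq_or_lt with h₀ | h₀
  · simpa [← h₀] using hb
  · exact hray _ h₀
end

section
/- Let n ≥ 2, let K ⊆ ℝⁿ be closed with dimH K < n − 1, and let b ∈ ℝⁿ with b ∉ K. Then there exists a continuous path α : [0, 1] → ℝⁿ with α(0) = 0, α(1) = b, α(t) ∉ K for every t ∈ (0, 1], and ‖α(t)‖ ≤ ‖b‖ for every t ∈ [0, 1]. -/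
open ENNReal
open Set Metric Module Filter Topology

section Avoidance

variable {E : Type*} [NormedAddCommGroup E] [InnerProductSpace ℝ E] [FiniteDimensional ℝ E]
  {K C : Set E} {x y : E}

/-- A segment can be translated by an arbitrarily small vector off a set whose Hausdorff dimension
is less than `finrank ℝ E - 1`. -/
theorem exists_norm_lt_segment_add_subset_compl (hK : dimH K < (finrank ℝ E : ℝ≥0∞) - 1)
    (hxy : x ≠ y) {ε : ℝ} (hε : 0 < ε) :
    ∃ v : E, ‖v‖ < ε ∧ segment ℝ (x + v) (y + v) ⊆ Kᶜ := by
  set W : Submodule ℝ E := (ℝ ∙ (y - x))ᗮ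
  set P := W.orthogonalProjectionOnto
  have hW : (finrank ℝ W : ℝ≥0∞) = (finrank ℝ E : ℝ≥0∞) - 1 := by
    have h := (ℝ ∙ (y - x)).finrank_add_finrank_orthogonal
    rw [finrank_span_singleton (sub_ne_zero.2 hxy.symm)] at h
    rw [← h, Nat.cast_add, Nat.cast_one]
    exact (ENNReal.add_sub_cancel_left ENNReal.one_ne_top).symm
  have hdense : Dense (P '' K)ᶜ := dense_compl_of_dimH_lt_finrank <|
    (dimH_orthogonalProjectionOnto_le W K).trans_lt (hW ▸ hK)
  obtain ⟨w, hw, hwx⟩ := hdense.exists_dist_lt (P x) hε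
  refine ⟨((w - P x : W) : E), ?_, ?_⟩
  · rwa [dist_comm, dist_eq_norm] at hwx
  · intro z hz hzK
    refine hw ⟨z, hzK, ?_⟩
    rw [segment_eq_image'] at hz
    obtain ⟨t, -, rfl⟩ := hz
    have hd : P (y - x) = 0 :=
      Submodule.orthogonalProjectionOnto_orthogonalComplement_singleton_eq_zero (y - x)
    simp only [add_sub_add_right_eq_sub, map_add, map_smul, hd, smul_zero, add_zero]
    rw [Submodule.orthogonalProjectionOnto_mem_subspace_eq_self]
    abel

/-- In an open convex set, a closed set of Hausdorff dimension less than `finrank ℝ E - 1` does not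
separate points. -/
theorem Convex.joinedIn_diff_of_isOpen (hC : Convex ℝ C) (hCo : IsOpen C) (hKc : IsClosed K)
    (hK : dimH K < (finrank ℝ E : ℝ≥0∞) - 1) (hx : x ∈ C \ K) (hy : y ∈ C \ K) :
    JoinedIn (C \ K) x y := by
  rcases eq_or_ne x y with rfl | hxy
  · exact .refl hx
  have hO : IsOpen (C \ K) := hCo.sdiff hKc
  obtain ⟨ε, hε, hεx⟩ := Metric.isOpen_iff.1 hO x hx
  obtain ⟨δ, hδ, hδy⟩ := Metric.isOpen_iff.1 hO y hy
  obtain ⟨v, hv, hvK⟩ := exists_norm_lt_segment_add_subset_compl hK hxy (lt_min hε hδ)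
  have hxv : x + v ∈ ball x ε := by simpa using hv.trans_le (min_le_left _ _)
  have hyv : y + v ∈ ball y δ := by simpa using hv.trans_le (min_le_right _ _)
  have h₁ : JoinedIn (C \ K) x (x + v) := .of_segment_subset
    (((convex_ball x ε).segment_subset (mem_ball_self hε) hxv).trans hεx)
  have h₂ : JoinedIn (C \ K) (x + v) (y + v) := .of_segment_subset fun z hz =>
    ⟨hC.segment_subset (hεx hxv).1 (hδy hyv).1 hz, hvK hz⟩
  have h₃ : JoinedIn (C \ K) (y + v) y := .of_segment_subset
    (((convex_ball y δ).segment_subset hyv (mem_ball_self hδ)).trans hδy)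
  exact (h₁.trans h₂).trans h₃

/-- A closed set of Hausdorff dimension less than `finrank ℝ E - 1` does not separate a point of a
convex set from an interior point. -/
theorem Convex.joinedIn_diff_of_mem_interior (hC : Convex ℝ C) (hKc : IsClosed K)
    (hK : dimH K < (finrank ℝ E : ℝ≥0∞) - 1) (hx : x ∈ C \ K) (hy : y ∈ interior C \ K) :
    JoinedIn (C \ K) x y := by
  obtain ⟨ε, hε, hεx⟩ := Metric.isOpen_iff.1 hKc.isOpen_compl x hx.2
  have hlim : Tendsto (AffineMap.lineMap x y : ℝ → E) (𝓝[>] 0) (𝓝 x) := by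
    have h : Continuous (AffineMap.lineMap x y : ℝ → E) := AffineMap.lineMap_continuous
    simpa using (h.tendsto 0).mono_left nhdsWithin_le_nhds
  obtain ⟨t, hzε, ht⟩ := ((hlim.eventually (ball_mem_nhds x hε)).and
    (Ioo_mem_nhdsGT (zero_lt_one' ℝ))).exists
  set z := AffineMap.lineMap x y t
  have hzC : z ∈ interior C := hC.openSegment_self_interior_subset_interior hx.1 hy.1
    (by rw [openSegment_eq_image_lineMap]; exact mem_image_of_mem _ ht)
  have h₁ : JoinedIn (C \ K) x z := .of_segment_subset fun w hw =>
    ⟨hC.segment_subset hx.1 (interior_subset hzC) hw,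
      hεx ((convex_ball x ε).segment_subset (mem_ball_self hε) hzε hw)⟩
  have h₂ : JoinedIn (interior C \ K) z y :=
    hC.interior.joinedIn_diff_of_isOpen isOpen_interior hKc hK ⟨hzC, hεx hzε⟩ hy
  exact h₁.trans (h₂.mono (sdiff_subset_sdiff_left interior_subset))

end Avoidance

/-- An infinite sequence of consecutive paths can be concatenated to a continuous function,
the `m`-th path being followed on `[m, m + 1]`. -/
theorem exists_continuous_eq_extend_sub_natCast {E : Type*} [AddCommGroup E] [TopologicalSpace E]
    [IsTopologicalAddGroup E] {x : ℕ → E} (γ : ∀ m, Path (x m) (x (m + 1))) :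
    ∃ β : ℝ → E, Continuous β ∧
      ∀ (m : ℕ) (s : ℝ), s ∈ Icc (m : ℝ) (m + 1) → β s = (γ m).extend (s - m) := by
  set F : ℕ → ℝ → E := fun N s => x 0 + ∑ k ∈ Finset.range N, ((γ k).extend (s - k) - x k)
  have hFc (N : ℕ) : Continuous (F N) := continuous_const.add <| continuous_finsetSum _
    fun k _ => ((γ k).continuous_extend.comp (continuous_id.sub continuous_const)).sub
      continuous_const
  have hF {N M : ℕ} (hNM : N ≤ M) {s : ℝ} (hs : s ≤ N) : F M s = F N s := by
    induction M, hNM using Nat.le_induction with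
    | base => rfl
    | succ M hNM ih =>
      have hsM : s - M ≤ 0 := by
        have : (N : ℝ) ≤ M := by exact_mod_cast hNM
        linarith
      rw [← ih]
      simp only [F, Finset.sum_range_succ, Path.extend_of_le_zero _ hsM, sub_self, add_zero]
  have hβ {N : ℕ} {s : ℝ} (hs : s ≤ N) : F ⌈s⌉₊ s = F N s :=
    (hF (Nat.ceil_le.2 hs) (Nat.le_ceil s)).symm
  refine ⟨fun s => F ⌈s⌉₊ s, continuous_iff_continuousAt.2 fun s => ?_, fun m s hs => ?_⟩
  · obtain ⟨N, hN⟩ := exists_nat_gt s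
    refine (hFc N).continuousAt.congr ?_
    filter_upwards [Iio_mem_nhds hN] with t ht using (hβ (le_of_lt ht)).symm
  · have hsum : F m s = x m := by
      have h : ∀ k ∈ Finset.range m, (γ k).extend (s - k) - x k = x (k + 1) - x k := by
        intro k hk
        have hkm : (k : ℝ) + 1 ≤ m := by exact_mod_cast Finset.mem_range.1 hk
        rw [Path.extend_of_one_le _ (by linarith [hs.1])]
      simp only [F]
      rw [Finset.sum_congr rfl h, Finset.sum_range_sub, add_sub_cancel]
    have hsucc : F (m + 1) s = F m s + ((γ m).extend (s - m) - x m) := by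
      simp only [F, Finset.sum_range_succ, add_assoc]
    change F ⌈s⌉₊ s = _
    rw [hβ (N := m + 1) (by exact_mod_cast hs.2), hsucc, hsum, add_sub_cancel]

/-- Step 1 of Theorem 2.2 with Remark 2.3: if `K` is closed with `dimH K < n - 1`
and `b ∉ K`, there is a continuous path `α` on `[0,1]` with `α 0 = 0`, `α 1 = b`,
avoiding `K` on `(0,1]`, and staying in the closed ball of radius `‖b‖`. -/
theorem exists_path_from_origin_avoiding
    (n : ℕ) (hn : 2 ≤ n) (K : Set (EuclideanSpace ℝ (Fin n))) (hK : IsClosed K)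
    (hdim : dimH K < (n : ℝ≥0∞) - 1)
    (b : EuclideanSpace ℝ (Fin n)) (hb : b ∉ K) :
    ∃ α : ℝ → EuclideanSpace ℝ (Fin n),
      ContinuousOn α (Set.Icc 0 1) ∧ α 0 = 0 ∧ α 1 = b ∧
      (∀ t ∈ Set.Ioc (0 : ℝ) 1, α t ∉ K) ∧
      (∀ t ∈ Set.Icc (0 : ℝ) 1, ‖α t‖ ≤ ‖b‖) := by
  rcases eq_or_ne b 0 with rfl | hb0
  · exact ⟨fun _ => 0, continuousOn_const, rfl, rfl, fun _ _ => hb, fun _ _ => le_rfl⟩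
  have hdim' : dimH K < (finrank ℝ (EuclideanSpace ℝ (Fin n)) : ℝ≥0∞) - 1 := by
    simpa using hdim
  have hdense : Dense Kᶜ := dense_compl_of_dimH_lt_finrank (hdim'.trans_le tsub_le_self)
  set r : ℕ → ℝ := fun m => ‖b‖ * (1 / 2) ^ m
  have hr (m : ℕ) : 0 < r m := by have := norm_pos_iff.2 hb0; positivity
  have hr_anti : Antitone r := fun m k hmk =>
    mul_le_mul_of_nonneg_left
      (pow_le_pow_of_le_one (by norm_num) (by norm_num) hmk) (norm_nonneg b)
  choose y hyK hy using fun m => hdense.exists_dist_lt 0 (hr m)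
  let x : ℕ → EuclideanSpace ℝ (Fin n) := fun m => Nat.casesOn m b fun k => y (k + 1)
  have hx (m : ℕ) : x m ∈ closedBall 0 (r m) \ K := by
    cases m with
    | zero => exact ⟨by simp [x, r], hb⟩
    | succ k => exact ⟨by rw [mem_closedBall, dist_comm]; exact (hy (k + 1)).le, hyK (k + 1)⟩
  have hx' (m : ℕ) : x (m + 1) ∈ interior (closedBall 0 (r m)) \ K := by
    refine ⟨ball_subset_interior_closedBall ?_, hyK (m + 1)⟩
    rw [mem_ball, dist_comm]
    exact (hy (m + 1)).trans_le (hr_anti m.le_succ)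
  have hjoin (m : ℕ) : JoinedIn (closedBall 0 (r m) \ K) (x m) (x (m + 1)) :=
    (convex_closedBall 0 (r m)).joinedIn_diff_of_mem_interior hK hdim' (hx m) (hx' m)
  obtain ⟨β, hβc, hβ⟩ := exists_continuous_eq_extend_sub_natCast fun m => (hjoin m).somePath
  have hβmem {s : ℝ} (hs : 0 ≤ s) : β s ∈ closedBall 0 (r ⌊s⌋₊) \ K := by
    have h₁ := Nat.floor_le hs
    have h₂ := (Nat.lt_floor_add_one s).le
    rw [hβ ⌊s⌋₊ s ⟨h₁, h₂⟩, Path.extend_apply _ ⟨by linarith, by linarith⟩]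
    exact (hjoin _).somePath_mem _
  have hβlim : Tendsto β atTop (𝓝 0) := by
    refine squeeze_zero_norm' (a := fun s => r ⌊s⌋₊) ?_ ?_
    · filter_upwards [eventually_ge_atTop 0] with s hs
      simpa using (hβmem hs).1
    · have h : Tendsto r atTop (𝓝 0) := by
        simpa [r] using (tendsto_pow_atTop_nhds_zero_of_lt_one (r := (1 / 2 : ℝ)) (by norm_num)
          (by norm_num)).const_mul ‖b‖
      exact h.comp tendsto_nat_floor_atTop
  have hs {t : ℝ} (ht : t ∈ Ioc (0 : ℝ) 1) : 0 ≤ t⁻¹ - 1 :=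
    sub_nonneg.2 ((one_le_inv₀ ht.1).2 ht.2)
  have hαpos {t : ℝ} (ht : 0 < t) :
      Function.update (fun t => β (t⁻¹ - 1)) 0 0 t = β (t⁻¹ - 1) :=
    Function.update_of_ne ht.ne' _ _
  refine ⟨Function.update (fun t => β (t⁻¹ - 1)) 0 0, fun t ht => ?_, Function.update_self .., ?_,
    fun t ht => ?_, fun t ht => ?_⟩
  · rcases ht.1.eq_or_lt with rfl | ht0
    · rw [continuousWithinAt_update_same]
      have h : Tendsto (fun t : ℝ => t⁻¹ - 1) (𝓝[>] 0) atTop :=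
        tendsto_atTop_add_const_right _ _ tendsto_inv_nhdsGT_zero
      exact (hβlim.comp h).mono_left <| nhdsWithin_mono _ fun t ht =>
        lt_of_le_of_ne ht.1.1 (Ne.symm ht.2)
    · refine ContinuousAt.continuousWithinAt ?_
      rw [continuousAt_update_of_ne ht0.ne']
      exact hβc.continuousAt.comp ((continuousAt_inv₀ ht0.ne').sub continuousAt_const)
  · rw [hαpos one_pos, inv_one, sub_self, hβ 0 0 (by simp)]
    simp [x]
  · rw [hαpos ht.1]
    exact (hβmem (hs ht)).2
  · rcases ht.1.eq_or_lt with rfl | ht0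
    · simp
    · rw [hαpos ht0]
      have h := (hβmem (hs ⟨ht0, ht.2⟩)).1
      rw [mem_closedBall_zero_iff] at h
      exact h.trans ((hr_anti (Nat.zero_le _)).trans_eq (by simp [r]))
end

section
/- Let n ≥ 2 and let K ⊆ ℝⁿ be closed with dimH K < n − 1. Then the complement ℝⁿ \ K is path-connected: for any a, b ∈ ℝⁿ \ K there exists a continuous path α : [0,1] → ℝⁿ with α(0) = a, α(1) = b, and α(t) ∉ K for all t ∈ [0,1]. -/
open ENNReal

/-- In a finite-dimensional real inner product space, a closed set of codimension greater than one
(in the sense of Hausdorff dimension) has path-connected complement: push the segment `[a, b]`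
off the set by a small translation orthogonal to `b - a`. -/
theorem IsClosed.isPathConnected_compl_of_dimH_add_one_lt_finrank {E : Type*}
    [NormedAddCommGroup E] [InnerProductSpace ℝ E] [FiniteDimensional ℝ E] {K : Set E}
    (hK : IsClosed K) (hdim : dimH K + 1 < Module.finrank ℝ E) : IsPathConnected Kᶜ := by
  refine isPathConnected_iff.2
    ⟨(dense_compl_of_dimH_lt_finrank (le_self_add.trans_lt hdim)).nonempty, fun a ha b hb ↦ ?_⟩
  rcases eq_or_ne a b with rfl | hab
  · exact JoinedIn.refl ha
  obtain ⟨r, hr, har⟩ := Metric.isOpen_iff.1 hK.isOpen_compl a ha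
  obtain ⟨s, hs, hbs⟩ := Metric.isOpen_iff.1 hK.isOpen_compl b hb
  set V : Submodule ℝ E := (ℝ ∙ (b - a))ᗮ
  have hrank : dimH (V.orthogonalProjectionOnto '' K) < Module.finrank ℝ V := by
    have h := (ℝ ∙ (b - a)).finrank_add_finrank_orthogonal
    rw [finrank_span_singleton (sub_ne_zero.2 hab.symm)] at h
    rw [← h, add_comm, Nat.cast_add, Nat.cast_one] at hdim
    exact (dimH_orthogonalProjectionOnto_le V K).trans_lt
      ((ENNReal.add_lt_add_iff_left one_ne_top).1 hdim)
  obtain ⟨q, hq, hqd⟩ := (dense_compl_of_dimH_lt_finrank hrank).exists_dist_lt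
    (V.orthogonalProjectionOnto a) (lt_min hr hs)
  set w : V := q - V.orthogonalProjectionOnto a
  have hwn : ‖(w : E)‖ < min r s := by
    rwa [dist_comm, dist_eq_norm] at hqd
  have hside (x : E) (t : ℝ) (ht : ‖(w : E)‖ < t) (hx : Metric.ball x t ⊆ Kᶜ) :
      JoinedIn Kᶜ x (x + w) := by
    refine JoinedIn.of_segment_subset (((convex_ball x t).segment_subset ?_ ?_).trans hx)
    · exact Metric.mem_ball_self ((norm_nonneg _).trans_lt ht)
    · simpa using ht
  refine (hside a r (hwn.trans_le (min_le_left _ _)) har).trans (.trans ?_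
    (hside b s (hwn.trans_le (min_le_right _ _)) hbs).symm)
  refine JoinedIn.of_segment_subset ?_
  rw [segment_eq_image']
  rintro _ ⟨t, -, rfl⟩ hmem
  refine hq ⟨_, hmem, ?_⟩
  have hproj : V.orthogonalProjectionOnto (b - a) = 0 := by
    rw [Submodule.orthogonalProjectionOnto_eq_zero_iff]
    exact Submodule.le_orthogonal_orthogonal _ (Submodule.mem_span_singleton_self _)
  have hsum : V.orthogonalProjectionOnto a + w = q := add_sub_cancel _ _
  simpa [hproj] using hsum

/-- A closed set of Hausdorff dimension less than `n - 1` does not disconnect `ℝⁿ`: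
its complement is path-connected. -/
theorem complement_pathConnected_of_dimH_lt
    (n : ℕ) (hn : 2 ≤ n) (K : Set (EuclideanSpace ℝ (Fin n))) (hK : IsClosed K)
    (hdim : dimH K < (n : ℝ≥0∞) - 1) :
    ∀ a ∈ Kᶜ, ∀ b ∈ Kᶜ,
      ∃ α : ℝ → EuclideanSpace ℝ (Fin n),
        ContinuousOn α (Set.Icc 0 1) ∧ α 0 = a ∧ α 1 = b ∧
        ∀ t ∈ Set.Icc (0 : ℝ) 1, α t ∉ K := by
  intro a ha b hb
  have hK' : IsPathConnected Kᶜ :=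
    hK.isPathConnected_compl_of_dimH_add_one_lt_finrank
      (by simpa using lt_tsub_iff_right.1 hdim)
  obtain ⟨γ, hγ⟩ := hK'.joinedIn a ha b hb
  exact ⟨γ.extend, γ.continuous_extend.continuousOn, γ.extend_zero, γ.extend_one,
    fun t ht ↦ by simpa [γ.extend_apply ht] using hγ ⟨t, ht⟩⟩
end

section
/- Let n ≥ 2, let X ⊆ ℝⁿ be closed and let M ⊆ ℝⁿ be compact with M ∩ X = ∅. Let K = {y − x : y ∈ X, x ∈ M} and assume dimH K < n − 1. Let x₀ ∈ M and let y₀ ∈ ℝⁿ be such that x + (y₀ − x₀) ∉ X for every x ∈ M. Then there exists a continuous map α : [0,1] → ℝⁿ with α(0) = 0 and α(1) = y₀ − x₀ such that the motion F : M × [0,1] → ℝⁿ, F(x,t) = x + α(t), satisfies F(x,0) = x for all x ∈ M, each time slice x ↦ F(x,t) is an isometry of M onto its image, F(x,t) ∉ X for all x ∈ M and t ∈ [0,1], and F(x₀,1) = y₀. -/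
open ENNReal

open Module Metric in
/-- Any two points outside a closed set `K` with `dimH K < dim E - 1` are joined by a path
avoiding `K`. -/
theorem IsClosed.joinedIn_compl_of_dimH_lt {E : Type*} [NormedAddCommGroup E]
    [InnerProductSpace ℝ E] [FiniteDimensional ℝ E] {K : Set E} (hK : IsClosed K)
    (hdim : dimH K < (finrank ℝ E : ℝ≥0∞) - 1) {a b : E} (ha : a ∉ K) (hb : b ∉ K) :
    JoinedIn Kᶜ a b := by
  rcases eq_or_ne a b with rfl | hab
  · exact JoinedIn.refl ha
  let V : Submodule ℝ E := (Submodule.span ℝ {b - a})ᗮ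
  let p : E →L[ℝ] V := V.orthogonalProjectionOnto
  have hp : p (b - a) = 0 :=
    Submodule.orthogonalProjectionOnto_orthogonalComplement_singleton_eq_zero (b - a)
  have hV : (finrank ℝ E : ℝ≥0∞) - 1 = finrank ℝ V := by
    have h := (Submodule.span ℝ {b - a}).finrank_add_finrank_orthogonal
    rw [finrank_span_singleton (sub_ne_zero.2 hab.symm)] at h
    rw [← h, Nat.cast_add, Nat.cast_one, ENNReal.add_sub_cancel_left ENNReal.one_ne_top]
  have hdense : Dense (p '' K)ᶜ := dense_compl_of_dimH_lt_finrank <|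
    (dimH_orthogonalProjectionOnto_le V K).trans_lt (hV ▸ hdim)
  obtain ⟨r, hr, har⟩ := Metric.isOpen_iff.1 hK.isOpen_compl a ha
  obtain ⟨s, hs, hbs⟩ := Metric.isOpen_iff.1 hK.isOpen_compl b hb
  obtain ⟨w, hwK, hw⟩ := hdense.exists_dist_lt (p a) (lt_min hr hs)
  obtain ⟨u, rfl⟩ : ∃ u : V, w = p a + u := ⟨w - p a, by abel⟩
  have hu : ‖(u : E)‖ < min r s := by simpa [dist_eq_norm] using hw
  have near {c : E} {ρ : ℝ} (hρ : ‖(u : E)‖ < ρ) (hc : ball c ρ ⊆ Kᶜ) :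
      JoinedIn Kᶜ c (c + u) :=
    JoinedIn.of_segment_subset <| ((convex_ball c ρ).segment_subset
      (mem_ball_self ((norm_nonneg _).trans_lt hρ)) (by simpa [dist_eq_norm] using hρ)).trans hc
  refine (near (hu.trans_le (min_le_left _ _)) har).trans
    (JoinedIn.trans (JoinedIn.of_segment_subset ?_)
      (near (hu.trans_le (min_le_right _ _)) hbs).symm)
  rw [segment_eq_image']
  rintro _ ⟨t, -, rfl⟩ hx
  refine hwK ⟨_, hx, ?_⟩
  have hpu : p u = u := V.orthogonalProjectionOnto_mem_subspace_eq_self u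
  dsimp only
  rw [add_sub_add_right_eq_sub, map_add, map_add, map_smul, hp, hpu, smul_zero, add_zero]

/-- Theorem 2.2 (parts (1) and (2)): if `X` is closed, `M` is compact and disjoint
from `X`, the difference set `K = X - M` has `dimH K < n - 1`, and the translate of
`M` by `y₀ - x₀` avoids `X`, then there is a motion of `M` by translations that
avoids `X` throughout and carries `x₀` to `y₀`. -/
theorem exists_translation_motion_avoiding
    (n : ℕ) (hn : 2 ≤ n) (X : Set (EuclideanSpace ℝ (Fin n))) (hX : IsClosed X)
    (M : Set (EuclideanSpace ℝ (Fin n))) (hM : IsCompact M) (hMX : M ∩ X = ∅)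
    (hdim : dimH {d : EuclideanSpace ℝ (Fin n) | ∃ y ∈ X, ∃ x ∈ M, d = y - x}
      < (n : ℝ≥0∞) - 1)
    (x₀ : EuclideanSpace ℝ (Fin n)) (hx₀ : x₀ ∈ M)
    (y₀ : EuclideanSpace ℝ (Fin n)) (hy₀ : ∀ x ∈ M, x + (y₀ - x₀) ∉ X) :
    ∃ α : ℝ → EuclideanSpace ℝ (Fin n),
      ContinuousOn α (Set.Icc 0 1) ∧ α 0 = 0 ∧ α 1 = y₀ - x₀ ∧
      (∀ x ∈ M, x + α 0 = x) ∧
      (∀ t ∈ Set.Icc (0 : ℝ) 1, ∀ x ∈ M, ∀ y ∈ M,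
        dist (x + α t) (y + α t) = dist x y) ∧
      (∀ x ∈ M, ∀ t ∈ Set.Icc (0 : ℝ) 1, x + α t ∉ X) ∧
      x₀ + α 1 = y₀ := by
  set K : Set (EuclideanSpace ℝ (Fin n)) := {d | ∃ y ∈ X, ∃ x ∈ M, d = y - x} with hKdef
  have hK : IsClosed K := by
    convert hX.add_right_of_isCompact hM.neg using 1
    ext d
    simp only [hKdef, Set.mem_ofPred_eq, Set.mem_add, Set.mem_neg]
    constructor
    · rintro ⟨y, hy, x, hx, rfl⟩
      exact ⟨y, hy, -x, by simpa using hx, (sub_eq_add_neg y x).symm⟩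
    · rintro ⟨y, hy, x, hx, rfl⟩
      exact ⟨y, hy, -x, hx, by simp⟩
  have avoid {v : EuclideanSpace ℝ (Fin n)} : v ∉ K ↔ ∀ x ∈ M, x + v ∉ X := by
    refine ⟨fun hv x hx hxv => hv ⟨_, hxv, x, hx, by simp⟩, ?_⟩
    rintro h ⟨y, hy, x, hx, rfl⟩
    exact h x hx (by simpa using hy)
  have h0 : (0 : EuclideanSpace ℝ (Fin n)) ∉ K := avoid.2 fun x hx hxX =>
    (Set.eq_empty_iff_forall_notMem.1 hMX x) ⟨hx, by simpa using hxX⟩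
  obtain ⟨γ, hγ⟩ := hK.joinedIn_compl_of_dimH_lt
    (by simpa using hdim) h0 (avoid.2 hy₀)
  refine ⟨γ.extend, γ.continuous_extend.continuousOn, γ.extend_zero, γ.extend_one,
    by simp, by simp, fun x hx t ht => ?_, by simp⟩
  rw [γ.extend_apply ht]
  exact avoid.1 (hγ ⟨t, ht⟩) x hx
end

section
/- Let n ≥ 2, let m be a natural number, let X ⊆ ℝⁿ be closed with dimH X < n − m − 1, and let M ⊆ ℝⁿ be a set of the form M = f(K₀) where K₀ ⊆ ℝᵐ is compact and f : ℝᵐ → ℝⁿ is Lipschitz, with M nonempty and M ∩ X = ∅. Let x₀ ∈ M and let y₀ ∈ ℝⁿ be such that x + (y₀ − x₀) ∉ X for every x ∈ M. Then there exists a continuous map α : [0,1] → ℝⁿ with α(0) = 0 and α(1) = y₀ − x₀ such that x + α(t) ∉ X for all x ∈ M and all t ∈ [0,1]; in particular the motion F(x,t) = x + α(t) of M avoids X throughout, each time slice is an isometry of M onto its image, and it carries x₀ to the prescribed target y₀. -/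
open ENNReal

open MeasureTheory Metric Set Topology

/-- The pre-measure bound behind `dimH_prod_univ_pi_le`: a unit cube is covered by about
`ε⁻¹ ^ card ι` cubes of side `ε`. -/
theorem mkMetric'_pre_prod_unitCube_le {X ι : Type*} [EMetricSpace X] [Fintype ι] {d : ℝ}
    (hd : 0 ≤ d) (z : ι → ℝ) (s : Set X) {r : ℝ≥0∞} {ε : ℝ} (hε : 0 < ε) (hε1 : ε ≤ 1)
    (hεr : ENNReal.ofReal ε ≤ r) (hs : ediam s ≤ ENNReal.ofReal ε) :
    OuterMeasure.mkMetric'.pre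
        (fun u : Set (X × (ι → ℝ)) ↦ ediam u ^ (d + Fintype.card ι)) r (s ×ˢ Icc z (z + 1)) ≤
      2 ^ Fintype.card ι * ENNReal.ofReal ε ^ d := by
  classical
  set N : ℕ := ⌊1 / ε⌋₊ + 1 with hN
  let Q : (ι → Fin N) → Set (ι → ℝ) := fun j ↦
    Set.pi univ fun i ↦ Icc (z i + (j i : ℕ) * ε) (z i + (j i : ℕ) * ε + ε)
  have hQ (j) : ediam (s ×ˢ Q j) ≤ ENNReal.ofReal ε := by
    refine ediam_le fun p hp q hq ↦ ?_
    rw [Prod.edist_eq]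
    refine max_le ((edist_le_ediam_of_mem hp.1 hq.1).trans hs) ?_
    refine (edist_le_ediam_of_mem hp.2 hq.2).trans (ediam_pi_le_of_le fun i ↦ ?_)
    simp [Real.ediam_Icc]
  have hcover : s ×ˢ Icc z (z + 1) ⊆ ⋃ j, s ×ˢ Q j := by
    rintro ⟨x, y⟩ ⟨hx, hy⟩
    have hnonneg (i) : 0 ≤ (y i - z i) / ε := div_nonneg (sub_nonneg.2 (hy.1 i)) hε.le
    have hlt (i) : ⌊(y i - z i) / ε⌋₊ < N := by
      rw [hN, Nat.lt_succ_iff]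
      have := hy.2 i
      simp only [Pi.add_apply, Pi.one_apply] at this
      gcongr
      linarith
    refine mem_iUnion.2 ⟨fun i ↦ ⟨_, hlt i⟩, hx, fun i _ ↦ ?_⟩
    have h1 := Nat.floor_le (hnonneg i)
    have h2 := Nat.lt_floor_add_one ((y i - z i) / ε)
    rw [le_div_iff₀ hε] at h1
    rw [div_lt_iff₀ hε] at h2
    constructor <;> simp only <;> linarith
  have hNε : (N : ℝ≥0∞) * ENNReal.ofReal ε ≤ 2 := by
    rw [← ENNReal.ofReal_natCast, ← ENNReal.ofReal_mul (by positivity)]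
    refine ENNReal.ofReal_le_of_le_toReal ?_
    have := Nat.floor_le (show 0 ≤ 1 / ε by positivity)
    have h3 : (⌊1 / ε⌋₊ : ℝ) * ε ≤ 1 := (le_div_iff₀ hε).1 this
    push_cast [hN]
    simp only [ENNReal.toReal_ofNat]
    linarith
  calc _ ≤ _ := measure_mono hcover
    _ ≤ ∑ j, _ := measure_iUnion_fintype_le _ _
    _ ≤ ∑ _j : ι → Fin N, ENNReal.ofReal ε ^ (d + Fintype.card ι) := by
      refine Finset.sum_le_sum fun j _ ↦
        (OuterMeasure.mkMetric'.pre_le ((hQ j).trans hεr)).trans ?_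
      exact ENNReal.rpow_le_rpow (hQ j) (by positivity)
    _ = ((N : ℝ≥0∞) * ENNReal.ofReal ε) ^ Fintype.card ι * ENNReal.ofReal ε ^ d := by
      rw [ENNReal.rpow_add_of_nonneg _ _ hd (by positivity), ENNReal.rpow_natCast]
      simp
      ring
    _ ≤ _ := by gcongr

/-- If `s` is null for `μH[d]`, then its product with a unit cube in `ℝ ^ ι` is null for
`μH[d + card ι]`. -/
theorem hausdorffMeasure_prod_unitCube_eq_zero {X ι : Type*} [EMetricSpace X] [Fintype ι]
    [MeasurableSpace X] [BorelSpace X] [MeasurableSpace (X × (ι → ℝ))]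
    [BorelSpace (X × (ι → ℝ))] {d : ℝ} (hd : 0 < d) (z : ι → ℝ) {s : Set X}
    (hs : μH[d] s = 0) : μH[d + Fintype.card ι] (s ×ˢ Icc z (z + 1)) = 0 := by
  rw [Measure.hausdorffMeasure, ← OuterMeasure.coe_mkMetric] at hs ⊢
  set pre := OuterMeasure.mkMetric'.pre
    (fun u : Set (X × (ι → ℝ)) ↦ ediam u ^ (d + Fintype.card ι))
  have hpre (r : ℝ≥0∞) (hr : 0 < r) : pre r (s ×ˢ Icc z (z + 1)) = 0 := by
    let ν : OuterMeasure X :=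
      OuterMeasure.map Prod.fst (OuterMeasure.restrict (univ ×ˢ Icc z (z + 1)) (pre r))
    have hν (u : Set X) : ν u = pre r (u ×ˢ Icc z (z + 1)) := by
      simp only [ν, OuterMeasure.map_apply, OuterMeasure.restrict_apply]
      congr 1
      ext; simp
    have hle : ν ≤ OuterMeasure.mkMetric ((2 ^ Fintype.card ι : ℝ≥0∞) • fun t ↦ t ^ d) := by
      refine OuterMeasure.le_mkMetric _ ν (min r 1) (by simp [hr]) fun u hu ↦ ?_
      rw [hν]
      have hfin : ediam u ≠ ∞ := ne_top_of_le_ne_top one_ne_top (hu.trans (min_le_right _ _))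
      rcases eq_or_ne (ediam u) 0 with h0 | h0
      · have key : ∀ᶠ ε : ℝ in 𝓝[>] 0, pre r (u ×ˢ Icc z (z + 1)) ≤
            2 ^ Fintype.card ι * ENNReal.ofReal ε ^ d := by
          have hr' : ∀ᶠ ε : ℝ in 𝓝[>] 0, ENNReal.ofReal ε < r := by
            refine nhdsWithin_le_nhds ?_
            exact ENNReal.continuous_ofReal.continuousAt.eventually_lt_const (by simpa)
          filter_upwards [Ioc_mem_nhdsGT one_pos, hr'] with ε h1 h2
          exact mkMetric'_pre_prod_unitCube_le hd.le z u h1.1 h1.2 h2.le (by simp [h0])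
        refine ge_of_tendsto (f := fun ε : ℝ ↦ 2 ^ Fintype.card ι * ENNReal.ofReal ε ^ d) ?_ key
        have : Filter.Tendsto (fun ε : ℝ ↦ ENNReal.ofReal ε ^ d) (𝓝[>] 0) (𝓝 (ediam u ^ d)) := by
          rw [h0]
          refine Filter.Tendsto.mono_left ?_ nhdsWithin_le_nhds
          refine (ENNReal.continuous_rpow_const.comp ENNReal.continuous_ofReal).tendsto' _ _ ?_
          simp
        exact ENNReal.Tendsto.const_mul this (Or.inr (by finiteness))
      · have := mkMetric'_pre_prod_unitCube_le (ι := ι) hd.le z u (r := r)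
          (ENNReal.toReal_pos h0 hfin)
          (ENNReal.toReal_le_of_le_ofReal zero_le_one (by simpa using hu.trans (min_le_right _ _)))
          (by rw [ENNReal.ofReal_toReal hfin]; exact hu.trans (min_le_left _ _))
          (by rw [ENNReal.ofReal_toReal hfin])
        rwa [ENNReal.ofReal_toReal hfin] at this
    rw [← hν, ← nonpos_iff_eq_zero]
    refine (hle s).trans ?_
    rw [OuterMeasure.mkMetric_smul _ (by finiteness) (by simp), _root_.smul_apply, hs]
    simp
  rw [OuterMeasure.mkMetric, OuterMeasure.mkMetric']
  simp only [OuterMeasure.iSup_apply, ENNReal.iSup_eq_zero]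
  exact hpre

/-- Multiplying by `ℝ ^ ι` increases the Hausdorff dimension by at most `card ι`. -/
theorem dimH_prod_univ_pi_le {X : Type*} (ι : Type*) [EMetricSpace X] [Fintype ι] (s : Set X) :
    dimH (s ×ˢ (univ : Set (ι → ℝ))) ≤ dimH s + Fintype.card ι := by
  let _ : MeasurableSpace X := borel X
  have : BorelSpace X := ⟨rfl⟩
  let _ : MeasurableSpace (X × (ι → ℝ)) := borel _
  have : BorelSpace (X × (ι → ℝ)) := ⟨rfl⟩
  have hU : s ×ˢ (univ : Set (ι → ℝ)) =
      ⋃ z : ι → ℤ, s ×ˢ Icc (fun i ↦ (z i : ℝ)) ((fun i ↦ (z i : ℝ)) + 1) := by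
    rw [← prod_iUnion]
    congr 1
    symm
    exact eq_univ_of_forall fun y ↦ mem_iUnion.2
      ⟨fun i ↦ ⌊y i⌋, fun i ↦ Int.floor_le _, fun i ↦ (Int.lt_floor_add_one _).le⟩
  rw [hU, dimH_iUnion]
  refine iSup_le fun z ↦ ?_
  refine ENNReal.le_of_forall_pos_le_add fun ε hε hfin ↦ ?_
  have hs : dimH s ≠ ∞ := fun h ↦ by simp [h] at hfin
  lift dimH s to NNReal using hs with D hD
  have h0 : μH[((D + ε : NNReal) : ℝ)] s = 0 := by
    refine hausdorffMeasure_of_dimH_lt ?_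
    rw [← hD]
    exact_mod_cast lt_add_of_pos_right D hε
  have h1 := hausdorffMeasure_prod_unitCube_eq_zero (ι := ι) (by positivity)
    (fun i ↦ (z i : ℝ)) h0
  have h2 : dimH (s ×ˢ Icc (fun i ↦ (z i : ℝ)) ((fun i ↦ (z i : ℝ)) + 1)) ≤
      ((D + ε + Fintype.card ι : NNReal) : ℝ≥0∞) := by
    refine dimH_le_of_hausdorffMeasure_ne_top ?_
    push_cast at h1 ⊢
    rw [h1]
    exact zero_ne_top
  refine h2.trans (le_of_eq ?_)
  push_cast
  ring

/-- The union of the lines joining `a` to points of the difference set `s - range f`, with `f`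
Lipschitz on an `m`-dimensional space, has dimension at most `dimH s + m + 1`. -/
theorem dimH_cone_sub_le {E : Type*} [NormedAddCommGroup E] [NormedSpace ℝ E]
    [FiniteDimensional ℝ E] {m : ℕ} {f : EuclideanSpace ℝ (Fin m) → E} {C : NNReal}
    (hf : LipschitzWith C f) (s : Set E) (a : E) :
    dimH {p | ∃ c : ℝ, ∃ x ∈ s, ∃ k, p = a + c • (x - f k - a)} ≤ dimH s + m + 1 := by
  let A : E × (Fin (m + 1) → ℝ) → ℝ × E := fun q ↦
    (q.2 0, q.1 - f (WithLp.toLp 2 (Fin.tail q.2)) - a)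
  let B : ℝ × E → E := fun q ↦ a + q.1 • q.2
  have hA : ∃ K, LipschitzWith K A := by
    have h0 : LipschitzWith 1 fun q : E × (Fin (m + 1) → ℝ) ↦ q.2 0 :=
      (LipschitzWith.eval (α := fun _ : Fin (m + 1) ↦ ℝ) 0).comp LipschitzWith.prod_snd
        |>.weaken (by simp)
    have ht : LipschitzWith 1 fun q : E × (Fin (m + 1) → ℝ) ↦ Fin.tail q.2 := by
      refine LipschitzWith.of_edist_le fun q q' ↦ ?_
      refine edist_pi_le_iff.2 fun i ↦ (edist_le_pi_edist q.2 q'.2 i.succ).trans ?_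
      exact le_max_right _ _
    have h1 := (hf.comp ((PiLp.lipschitzWith_toLp 2 fun _ : Fin m ↦ ℝ).comp ht))
    exact ⟨_, h0.prodMk ((LipschitzWith.prod_fst.sub h1).sub (LipschitzWith.const a))⟩
  obtain ⟨K, hK⟩ := hA
  have hB : LocallyLipschitz B := by
    have : ContDiff ℝ 1 B := by fun_prop
    exact this.locallyLipschitz
  have hBA : LocallyLipschitz (B ∘ A) := hB.comp hK.locallyLipschitz
  have hsub : {p | ∃ c : ℝ, ∃ x ∈ s, ∃ k, p = a + c • (x - f k - a)} ⊆
      B ∘ A '' (s ×ˢ univ) := by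
    rintro p ⟨c, x, hx, k, rfl⟩
    exact ⟨(x, Fin.cons c k.ofLp), ⟨hx, mem_univ _⟩, by simp [A, B]⟩
  calc _ ≤ _ := dimH_mono hsub
    _ ≤ _ := dimH_image_le_of_locally_lipschitzOn fun q _ ↦ by
      obtain ⟨K', t, ht, h⟩ := hBA q
      exact ⟨K', t, mem_nhdsWithin_of_mem_nhds ht, h⟩
    _ ≤ _ := dimH_prod_univ_pi_le _ s
    _ = _ := by simp [add_assoc]

/-- Theorem 2.2 of the paper: if `X` is closed with `dimH X < n - m - 1` and `M` is a
Lipschitz image of a compact subset of `ℝᵐ`, nonempty and disjoint from `X`, and the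
translate of `M` by `y₀ - x₀` avoids `X`, then there is a motion of `M` by
translations avoiding `X` throughout which carries `x₀` to `y₀`. -/
theorem exists_translation_motion_avoiding_of_lipschitz_image
    (n m : ℕ) (hn : 2 ≤ n) (X : Set (EuclideanSpace ℝ (Fin n))) (hX : IsClosed X)
    (hdim : dimH X < (n : ℝ≥0∞) - m - 1)
    (K₀ : Set (EuclideanSpace ℝ (Fin m))) (hK₀ : IsCompact K₀)
    (f : EuclideanSpace ℝ (Fin m) → EuclideanSpace ℝ (Fin n))
    (hf : ∃ C : NNReal, LipschitzWith C f)
    (M : Set (EuclideanSpace ℝ (Fin n))) (hMdef : M = f '' K₀)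
    (hMne : M.Nonempty) (hMX : M ∩ X = ∅)
    (x₀ : EuclideanSpace ℝ (Fin n)) (hx₀ : x₀ ∈ M)
    (y₀ : EuclideanSpace ℝ (Fin n)) (hy₀ : ∀ x ∈ M, x + (y₀ - x₀) ∉ X) :
    ∃ α : ℝ → EuclideanSpace ℝ (Fin n),
      ContinuousOn α (Set.Icc 0 1) ∧ α 0 = 0 ∧ α 1 = y₀ - x₀ ∧
      (∀ x ∈ M, ∀ t ∈ Set.Icc (0 : ℝ) 1, x + α t ∉ X) ∧
      (∀ t ∈ Set.Icc (0 : ℝ) 1, ∀ x ∈ M, ∀ y ∈ M,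
        dist (x + α t) (y + α t) = dist x y) ∧
      x₀ + α 1 = y₀ := by
  subst hMdef
  obtain ⟨C, hf⟩ := hf
  set v := y₀ - x₀
  set S : Set (EuclideanSpace ℝ (Fin n)) := {w | ∀ x ∈ f '' K₀, x + w ∉ X}
  have h0S : (0 : EuclideanSpace ℝ (Fin n)) ∈ S := fun x hx hxX ↦
    hMX.subset ⟨hx, by simpa using hxX⟩
  let cone (a : EuclideanSpace ℝ (Fin n)) : Set (EuclideanSpace ℝ (Fin n)) :=
    {p | ∃ c : ℝ, ∃ x ∈ X, ∃ k, p = a + c • (x - f k - a)}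
  have hdim' : dimH X + m + 1 < n := by
    rw [lt_tsub_iff_right, lt_tsub_iff_right] at hdim
    rwa [add_right_comm]
  obtain ⟨p, hp⟩ : (cone 0 ∪ cone v)ᶜ.Nonempty := by
    refine (dense_compl_of_dimH_lt_finrank ?_).nonempty
    rw [dimH_union, finrank_euclideanSpace_fin]
    exact max_lt ((dimH_cone_sub_le hf X 0).trans_lt hdim')
      ((dimH_cone_sub_le hf X v).trans_lt hdim')
  have hseg (a) (haS : a ∈ S) (hap : p ∉ cone a) : JoinedIn S a p := by
    refine JoinedIn.of_segment_subset ?_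
    rw [segment_eq_image']
    rintro _ ⟨c, -, rfl⟩
    rintro _ ⟨k, hk, rfl⟩ hX
    rcases eq_or_ne c 0 with rfl | hc
    · exact haS _ (mem_image_of_mem f hk) (by simpa using hX)
    · refine hap ⟨c⁻¹, _, hX, k, ?_⟩
      rw [show f k + (a + c • (p - a)) - f k - a = c • (p - a) by abel, inv_smul_smul₀ hc]
      abel
  rw [mem_compl_iff, mem_union, not_or] at hp
  obtain ⟨γ, hγ⟩ := (hseg 0 h0S hp.1).trans (hseg v hy₀ hp.2).symm
  refine ⟨γ.extend, γ.continuous_extend.continuousOn, γ.extend_zero, γ.extend_one,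
    fun x hx t ht ↦ ?_, fun t _ x _ y _ ↦ dist_add_right _ _ _, ?_⟩
  · rw [γ.extend_apply ht]
    exact hγ _ x hx
  · rw [γ.extend_one]
    exact add_sub_cancel x₀ y₀
end
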